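/- There exists a constant C ≥ 2, depending only on K and γ, such that the following holds. Under the probabilistic Fourier setup with diffusivity ν ∈ (0, e^{−1}], for every r with 2 ≤ r ≤ ν^{−1/2} / (C (log ν^{−1})^{1/2}) and every T ≥ C log r, one has 𝔼 Σ_{|k|≥r} |a_T(k)|² + 8π²ν ∫_0^T 𝔼 Σ_{|k|≥r} |k|² |a_t(k)|² dt ≥ 1/2. -/

import Mathlib

open MeasureTheory ENNReal Real Set
open scoped Classical

noncomputable section

/-- Euclidean norm of a lattice point `k ∈ ℤ^d`. -/
def znorm {d : ℕ} (k : Fin d → ℤ) : ℝ := Real.sqrt (∑ i, ((k i : ℝ)) ^ 2)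

/-- Euclidean norm of a vector in `ℂ^d`. -/
def cnorm {d : ℕ} (z : Fin d → ℂ) : ℝ := Real.sqrt (∑ i, ‖z i‖ ^ 2)

/-- Pairing `k · z = Σ_i k_i z_i`. -/
def zdot {d : ℕ} (k : Fin d → ℤ) (z : Fin d → ℂ) : ℂ := ∑ i, (k i : ℂ) * z i

/-- Divergence-free in Fourier variables: `k · v(k) = 0` for all `k`. -/
def DivFree {d : ℕ} (v : (Fin d → ℤ) → Fin d → ℂ) : Prop := ∀ k, zdot k (v k) = 0

/-- Fourier coefficients of a real vector field: `v(-k) = conj (v k)`. -/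
def RealCoeff {d : ℕ} (v : (Fin d → ℤ) → Fin d → ℂ) : Prop :=
  ∀ k i, v (-k) i = starRingEnd ℂ (v k i)

/-- A weight: nondecreasing on `[0,∞)` with values in `[1,∞]`. -/
def IsWeight (w : ℝ → ℝ≥0∞) : Prop :=
  MonotoneOn w (Set.Ici 0) ∧ ∀ s, 0 ≤ s → 1 ≤ w s

/-- Weighted ℓ¹ norm `‖w v‖_{ℓ¹} = Σ_k w(|k|)|v(k)|`. -/
def wl1 {d : ℕ} (w : ℝ → ℝ≥0∞) (v : (Fin d → ℤ) → Fin d → ℂ) : ℝ≥0∞ :=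
  ∑' k, w (znorm k) * ENNReal.ofReal (cnorm (v k))

/-- `(w⁻¹ * m_a)(r) = Σ_k w(||k|-r|)⁻¹ |a(k)|²`. -/
def convMass {d : ℕ} (w : ℝ → ℝ≥0∞) (a : (Fin d → ℤ) → ℂ) (r : ℝ) : ℝ≥0∞ :=
  ∑' k, (w |znorm k - r|)⁻¹ * (‖a k‖₊ : ℝ≥0∞) ^ 2

/-- `m_a(E) = Σ_{|k| ∈ E} |a(k)|²`. -/
def massOn {d : ℕ} (a : (Fin d → ℤ) → ℂ) (E : Set ℝ) : ℝ≥0∞ :=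
  ∑' k, if znorm k ∈ E then (‖a k‖₊ : ℝ≥0∞) ^ 2 else 0

/-- Logarithmic density measure `μ_{a,b}(E)`. -/
def logDensity (a b : ℝ) (E : Set ℝ) : ℝ≥0∞ :=
  (ENNReal.ofReal (Real.log (b / a)))⁻¹ * ∫⁻ r in E ∩ Set.Icc a b, ENNReal.ofReal r⁻¹

/-- The right-hand side of the Fourier advection–diffusion system. -/
def fourierRHS {d : ℕ} (ν : ℝ) (v : (Fin d → ℤ) → Fin d → ℂ) (a : (Fin d → ℤ) → ℂ)
    (k : Fin d → ℤ) : ℂ :=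
  Complex.ofReal (-(4 * π ^ 2 * ν * znorm k ^ 2)) * a k
    - 2 * Complex.ofReal π * Complex.I * ∑' j, zdot k (v (k - j)) * a j


/-- The probabilistic Fourier setup: joint measurability, `a_t(0)=0`, unit initial mass,
the a.s. energy identity, and the uniform-in-diffusivity exponential mixing bound. -/
def ProbSetup {d : ℕ} {Ω : Type*} [MeasurableSpace Ω] (ℙ : Measure Ω) (ν K γ : ℝ)
    (a : Ω → ℝ → (Fin d → ℤ) → ℂ) : Prop :=
  (∀ k : Fin d → ℤ, Measurable fun p : Ω × ℝ => a p.1 p.2 k) ∧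
  (∀ᵐ ω ∂ℙ,
    (∀ t : ℝ, a ω t 0 = 0) ∧
    (∑' k : Fin d → ℤ, (‖a ω 0 k‖₊ : ℝ≥0∞) ^ 2) = 1 ∧
    (∀ T > (0 : ℝ),
      (∑' k : Fin d → ℤ, (‖a ω T k‖₊ : ℝ≥0∞) ^ 2)
        + ENNReal.ofReal (8 * π ^ 2 * ν) *
          (∫⁻ t in Set.Ioc (0 : ℝ) T,
            ∑' k : Fin d → ℤ, ENNReal.ofReal (znorm k ^ 2) * (‖a ω t k‖₊ : ℝ≥0∞) ^ 2)
        = 1)) ∧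
  (∀ t : ℝ, 0 ≤ t →
    (∫⁻ ω, (∑' k : Fin d → ℤ, if k = 0 then 0 else
        (ENNReal.ofReal ((2 * π * znorm k) ^ 2))⁻¹ * (‖a ω t k‖₊ : ℝ≥0∞) ^ 2) ∂ℙ)
      ≤ ENNReal.ofReal (K * Real.exp (-γ * t)))

theorem znorm_nonneg {d : ℕ} (k : Fin d → ℤ) : 0 ≤ znorm k := Real.sqrt_nonneg _

theorem znorm_pos {d : ℕ} {k : Fin d → ℤ} (hk : k ≠ 0) : 0 < znorm k := by
  obtain ⟨i, hi⟩ := Function.ne_iff.mp hk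
  have hi' : (k i : ℝ) ≠ 0 := by exact_mod_cast hi
  exact Real.sqrt_pos.mpr (Finset.sum_pos' (fun j _ => sq_nonneg _)
    ⟨i, Finset.mem_univ i, by positivity⟩)

theorem tsum_split_ite {ι : Type*} (p : ι → Prop) (f : ι → ℝ≥0∞) :
    ∑' k, f k = (∑' k, if p k then f k else 0) + ∑' k, if p k then 0 else f k := by
  rw [← ENNReal.tsum_add]
  refine tsum_congr fun k => ?_
  split_ifs <;> simp

/-- The mass below frequency `r` is at most `(2πr)²` times the squared `H⁻¹` norm. -/
theorem low_mass_le_negSobolev {d : ℕ} (a : (Fin d → ℤ) → ℂ) (ha : a 0 = 0) (r : ℝ) :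
    (∑' k : Fin d → ℤ, if r ≤ znorm k then 0 else (‖a k‖₊ : ℝ≥0∞) ^ 2) ≤
      ENNReal.ofReal ((2 * π * r) ^ 2) * ∑' k : Fin d → ℤ, if k = 0 then 0 else
        (ENNReal.ofReal ((2 * π * znorm k) ^ 2))⁻¹ * (‖a k‖₊ : ℝ≥0∞) ^ 2 := by
  rw [← ENNReal.tsum_mul_left]
  refine ENNReal.tsum_le_tsum fun k => ?_
  by_cases hk : k = 0
  · subst hk
    simp [ha]
  by_cases hr : r ≤ znorm k
  · simp [hr]
  rw [if_neg hr, if_neg hk, ← mul_assoc]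
  have hz := znorm_pos hk
  have hpos : 0 < (2 * π * znorm k) ^ 2 := by positivity
  have hle : (2 * π * znorm k) ^ 2 ≤ (2 * π * r) ^ 2 := by
    have := (not_le.mp hr).le
    gcongr
  refine le_mul_of_one_le_left (zero_le) ?_
  rw [← ENNReal.mul_inv_cancel (ENNReal.ofReal_pos.mpr hpos).ne' ENNReal.ofReal_ne_top]
  gcongr

theorem low_dissipation_le_mass {d : ℕ} (a : (Fin d → ℤ) → ℂ) (r : ℝ) :
    (∑' k : Fin d → ℤ, if r ≤ znorm k then 0 else
        ENNReal.ofReal (znorm k ^ 2) * (‖a k‖₊ : ℝ≥0∞) ^ 2) ≤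
      ENNReal.ofReal (r ^ 2) *
        ∑' k : Fin d → ℤ, if r ≤ znorm k then 0 else (‖a k‖₊ : ℝ≥0∞) ^ 2 := by
  rw [← ENNReal.tsum_mul_left]
  refine ENNReal.tsum_le_tsum fun k => ?_
  split_ifs with h
  · simp
  · have h0 := znorm_nonneg k
    have := (not_le.mp h).le
    gcongr

theorem measurable_nnnorm_sq_coeff {d : ℕ} {Ω : Type*} [MeasurableSpace Ω]
    {a : Ω → ℝ → (Fin d → ℤ) → ℂ}
    (ha : ∀ k : Fin d → ℤ, Measurable fun p : Ω × ℝ => a p.1 p.2 k) (k : Fin d → ℤ) :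
    Measurable fun p : Ω × ℝ => (‖a p.1 p.2 k‖₊ : ℝ≥0∞) ^ 2 :=
  ((ha k).nnnorm.coe_nnreal_ennreal).pow_const 2

/-- The expected low-frequency mass is at most `1` and decays by mixing. -/
theorem expected_low_mass_le {d : ℕ} {Ω : Type*} [MeasurableSpace Ω] {ℙ : Measure Ω}
    [IsProbabilityMeasure ℙ] {ν K γ : ℝ} {a : Ω → ℝ → (Fin d → ℤ) → ℂ}
    (h : ProbSetup ℙ ν K γ a) (r : ℝ) {t : ℝ} (ht : 0 < t) :
    (∫⁻ ω, (∑' k : Fin d → ℤ, if r ≤ znorm k then 0 else (‖a ω t k‖₊ : ℝ≥0∞) ^ 2) ∂ℙ) ≤ 1 ∧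
    (∫⁻ ω, (∑' k : Fin d → ℤ, if r ≤ znorm k then 0 else (‖a ω t k‖₊ : ℝ≥0∞) ^ 2) ∂ℙ) ≤
      ENNReal.ofReal ((2 * π * r) ^ 2 * (K * Real.exp (-γ * t))) := by
  obtain ⟨-, has, hmix⟩ := h
  constructor
  · calc _ ≤ ∫⁻ _, 1 ∂ℙ := by
          refine lintegral_mono_ae ?_
          filter_upwards [has] with ω hω
          rw [← hω.2.2 t ht]
          refine le_trans (ENNReal.tsum_le_tsum fun k => ?_) le_self_add
          split_ifs <;> simp
      _ = 1 := by simp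
  · calc _ ≤ ∫⁻ ω, ENNReal.ofReal ((2 * π * r) ^ 2) * (∑' k : Fin d → ℤ, if k = 0 then 0 else
            (ENNReal.ofReal ((2 * π * znorm k) ^ 2))⁻¹ * (‖a ω t k‖₊ : ℝ≥0∞) ^ 2) ∂ℙ := by
          refine lintegral_mono_ae ?_
          filter_upwards [has] with ω hω
          exact low_mass_le_negSobolev (a ω t) (hω.1 t) r
      _ ≤ _ := by
          rw [lintegral_const_mul' _ _ ENNReal.ofReal_ne_top,
            ENNReal.ofReal_mul (sq_nonneg _)]
          gcongr
          exact hmix t ht.le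

/-- Integral over `(0, T]` of a function bounded by a constant and by an exponential decay. -/
theorem lintegral_le_of_le_const_of_le_exp {f : ℝ → ℝ≥0∞} {A B γ s T : ℝ} (hA : 0 ≤ A)
    (hB : 0 ≤ B) (hγ : 0 < γ) (hs : 0 ≤ s) (h₁ : ∀ t, 0 < t → f t ≤ ENNReal.ofReal A)
    (h₂ : ∀ t, 0 < t → f t ≤ ENNReal.ofReal (B * Real.exp (-γ * t))) :
    ∫⁻ t in Ioc (0 : ℝ) T, f t ≤
      ENNReal.ofReal (A * s + B * (Real.exp (-γ * s) / γ)) := by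
  have hsub : Ioc (0 : ℝ) T ⊆ Ioc 0 s ∪ Ioi s := by
    intro t ht
    rcases le_or_gt t s with h | h
    · exact Or.inl ⟨ht.1, h⟩
    · exact Or.inr h
  have hnn : 0 ≤ B * (Real.exp (-γ * s) / γ) := by positivity
  rw [ENNReal.ofReal_add (by positivity) hnn]
  refine (lintegral_mono_set hsub).trans ((lintegral_union_le _ _ _).trans (add_le_add ?_ ?_))
  · calc _ ≤ ∫⁻ _ in Ioc 0 s, ENNReal.ofReal A :=
          setLIntegral_mono measurable_const fun t ht => h₁ t ht.1
      _ = _ := by simp [ENNReal.ofReal_mul hA]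
  · calc _ ≤ ∫⁻ t in Ioi s, ENNReal.ofReal (B * Real.exp (-γ * t)) :=
          setLIntegral_mono (by fun_prop) fun t ht => h₂ t (hs.trans_lt ht)
      _ = _ := by
          rw [← ofReal_integral_eq_lintegral_ofReal, integral_const_mul,
            integral_exp_mul_Ioi (neg_lt_zero.mpr hγ), neg_div_neg_eq]
          · exact (integrableOn_exp_mul_Ioi (neg_lt_zero.mpr hγ) s).const_mul B
          · exact Filter.Eventually.of_forall fun t => by positivity

theorem mixing_remainder_le {K γ C r T : ℝ} (hK : 1 ≤ K) (hγ : 0 < γ)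
    (hC : 2 + 32 * π ^ 2 * K ≤ γ * C) (hr : 2 ≤ r) (hT : C * Real.log r ≤ T) :
    (2 * π * r) ^ 2 * (K * Real.exp (-γ * T)) ≤ 1 / 4 := by
  have hr0 : 0 < r := by linarith
  have hlog : 1 / 2 ≤ Real.log r := by
    have := Real.log_le_log (by norm_num) hr
    linarith [Real.log_two_gt_d9]
  set x : ℝ := 16 * π ^ 2 * K with hx
  have hx0 : 0 < x := by positivity
  have hexp : -γ * T ≤ -(2 * Real.log r) + -x := by
    have h1 : γ * (C * Real.log r) ≤ γ * T := by gcongr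
    have h2 : (2 + 2 * x) * Real.log r ≤ γ * C * Real.log r := by
      refine mul_le_mul_of_nonneg_right ?_ (by linarith)
      linarith
    nlinarith
  have hexp' : Real.exp (-γ * T) ≤ (r ^ 2)⁻¹ * x⁻¹ := by
    refine (Real.exp_le_exp.mpr hexp).trans ?_
    rw [Real.exp_add, Real.exp_neg, Real.exp_neg]
    have h3 : Real.exp (2 * Real.log r) = r ^ 2 := by
      rw [two_mul, Real.exp_add, Real.exp_log hr0, sq]
    rw [h3]
    gcongr
    linarith [Real.add_one_le_exp x]
  calc _ ≤ (2 * π * r) ^ 2 * (K * ((r ^ 2)⁻¹ * x⁻¹)) := by gcongr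
    _ = 1 / 4 := by
      rw [hx]
      have : K ≠ 0 := by positivity
      field_simp
      norm_num

theorem low_dissipation_bound {K γ C ν r : ℝ} (hK : 1 ≤ K) (hγ : 0 < γ) (hC2 : 2 ≤ C)
    (hC : 32 * π ^ 2 * ((1 + 4 * π ^ 2 * K) / γ) ≤ C) (hν : 0 < ν) (hν1 : ν ≤ Real.exp (-1))
    (hr : 2 ≤ r) (hrν : r ≤ ν ^ (-(1 / 2) : ℝ) / (C * Real.sqrt (Real.log ν⁻¹))) :
    8 * π ^ 2 * ν * (r ^ 2 * (2 / γ * Real.log r) + r ^ 2 * ((2 * π * r) ^ 2 * K) *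
      (Real.exp (-γ * (2 / γ * Real.log r)) / γ)) ≤ 1 / 4 := by
  have hr0 : 0 < r := by linarith
  set L := Real.log ν⁻¹ with hL
  have hL1 : 1 ≤ L := by
    rw [hL, Real.log_inv]
    have := Real.log_le_log hν hν1
    rw [Real.log_exp] at this
    linarith
  have hsL : 1 ≤ Real.sqrt L := Real.one_le_sqrt.mpr hL1
  have hCs : 1 ≤ C * Real.sqrt L := by nlinarith
  have hrC : r * (C * Real.sqrt L) ≤ ν ^ (-(1 / 2) : ℝ) := (le_div_iff₀ (by positivity)).mp hrν
  have hpow : (ν ^ (-(1 / 2) : ℝ)) ^ 2 = ν⁻¹ := by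
    rw [← Real.rpow_natCast, ← Real.rpow_mul hν.le]
    norm_num [Real.rpow_neg_one]
  have hsq : ν * r ^ 2 * (C ^ 2 * L) ≤ 1 := by
    have h := pow_le_pow_left₀ (by positivity) hrC 2
    rw [hpow, mul_pow, mul_pow, Real.sq_sqrt (by linarith)] at h
    have := mul_le_mul_of_nonneg_left h hν.le
    rw [mul_inv_cancel₀ hν.ne'] at this
    linarith
  have hlogr : 2 * Real.log r ≤ L := by
    have h1 : r ≤ ν ^ (-(1 / 2) : ℝ) := le_trans (by nlinarith) hrC
    have h2 := Real.log_le_log (by positivity) (pow_le_pow_left₀ hr0.le h1 2)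
    rw [hpow, Real.log_pow] at h2
    exact_mod_cast h2
  have hexp : Real.exp (-γ * (2 / γ * Real.log r)) = (r ^ 2)⁻¹ := by
    have : -γ * (2 / γ * Real.log r) = -(Real.log r + Real.log r) := by
      field_simp
      ring
    rw [this, Real.exp_neg, Real.exp_add, Real.exp_log hr0, sq]
  rw [hexp]
  have hD : 0 ≤ (1 + 4 * π ^ 2 * K) / γ := by positivity
  calc _ = 8 * π ^ 2 * (ν * r ^ 2) * ((2 * Real.log r + 4 * π ^ 2 * K) / γ) := by
        field_simp
        ring
    _ ≤ 8 * π ^ 2 * (ν * r ^ 2) * (((1 + 4 * π ^ 2 * K) / γ) * L) := by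
        rw [div_mul_eq_mul_div]
        gcongr
        have : 0 ≤ 4 * π ^ 2 * K := by positivity
        nlinarith
    _ = (32 * π ^ 2 * ((1 + 4 * π ^ 2 * K) / γ)) * (ν * r ^ 2 * L) / 4 := by ring
    _ ≤ C ^ 2 * (ν * r ^ 2 * L) / 4 := by
        gcongr
        nlinarith
    _ ≤ 1 / 4 := by linarith

/-- Splitting the expected energy identity at frequency `r`. -/
theorem expected_energy_split {d : ℕ} {Ω : Type*} [MeasurableSpace Ω] {ℙ : Measure Ω}
    [IsProbabilityMeasure ℙ] {ν K γ : ℝ} {a : Ω → ℝ → (Fin d → ℤ) → ℂ}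
    (h : ProbSetup ℙ ν K γ a) (r : ℝ) {T : ℝ} (hT : 0 < T) :
    1 = ((∫⁻ ω, massOn (a ω T) (Set.Ici r) ∂ℙ)
            + ENNReal.ofReal (8 * π ^ 2 * ν) *
              ∫⁻ t in Set.Ioc (0 : ℝ) T, ∫⁻ ω, (∑' k : Fin d → ℤ, if r ≤ znorm k then
                ENNReal.ofReal (znorm k ^ 2) * (‖a ω t k‖₊ : ℝ≥0∞) ^ 2 else 0) ∂ℙ) +
      ((∫⁻ ω, (∑' k : Fin d → ℤ, if r ≤ znorm k then 0 else (‖a ω T k‖₊ : ℝ≥0∞) ^ 2) ∂ℙ)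
            + ENNReal.ofReal (8 * π ^ 2 * ν) *
              ∫⁻ t in Set.Ioc (0 : ℝ) T, ∫⁻ ω, (∑' k : Fin d → ℤ, if r ≤ znorm k then 0 else
                ENNReal.ofReal (znorm k ^ 2) * (‖a ω t k‖₊ : ℝ≥0∞) ^ 2) ∂ℙ) := by
  obtain ⟨hmeas, has, -⟩ := h
  have hm := measurable_nnnorm_sq_coeff hmeas
  have hmT : ∀ k : Fin d → ℤ, Measurable fun ω => (‖a ω T k‖₊ : ℝ≥0∞) ^ 2 := fun k =>
    (hm k).comp measurable_prodMk_right
  have hhigh : Measurable fun p : Ω × ℝ => ∑' k : Fin d → ℤ, if r ≤ znorm k then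
      ENNReal.ofReal (znorm k ^ 2) * (‖a p.1 p.2 k‖₊ : ℝ≥0∞) ^ 2 else 0 := by
    refine Measurable.tsum fun k => ?_
    split_ifs
    · exact (hm k).const_mul _
    · exact measurable_const
  have htot : Measurable fun p : Ω × ℝ => ∑' k : Fin d → ℤ,
      ENNReal.ofReal (znorm k ^ 2) * (‖a p.1 p.2 k‖₊ : ℝ≥0∞) ^ 2 :=
    Measurable.tsum fun k => (hm k).const_mul _
  have hmass : Measurable fun ω => massOn (a ω T) (Set.Ici r) := by
    refine Measurable.tsum fun k => ?_
    split_ifs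
    · exact hmT k
    · exact measurable_const
  have hE : ∫⁻ ω, ((∑' k : Fin d → ℤ, (‖a ω T k‖₊ : ℝ≥0∞) ^ 2)
        + ENNReal.ofReal (8 * π ^ 2 * ν) *
          (∫⁻ t in Set.Ioc (0 : ℝ) T,
            ∑' k : Fin d → ℤ, ENNReal.ofReal (znorm k ^ 2) * (‖a ω t k‖₊ : ℝ≥0∞) ^ 2)) ∂ℙ
        = 1 := by
    calc _ = ∫⁻ _, 1 ∂ℙ := lintegral_congr_ae (has.mono fun ω hω => hω.2.2 T hT)
      _ = 1 := by simp
  rw [lintegral_add_left (Measurable.tsum hmT),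
    lintegral_const_mul' _ _ ENNReal.ofReal_ne_top,
    lintegral_lintegral_swap htot.aemeasurable] at hE
  have hsplitT : ∫⁻ ω, (∑' k : Fin d → ℤ, (‖a ω T k‖₊ : ℝ≥0∞) ^ 2) ∂ℙ =
      (∫⁻ ω, massOn (a ω T) (Set.Ici r) ∂ℙ) +
      ∫⁻ ω, (∑' k : Fin d → ℤ, if r ≤ znorm k then 0 else (‖a ω T k‖₊ : ℝ≥0∞) ^ 2) ∂ℙ := by
    rw [← lintegral_add_left hmass]
    refine lintegral_congr fun ω => ?_
    rw [tsum_split_ite fun k => r ≤ znorm k]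
    simp only [massOn, mem_Ici]
  have hsplit : ∫⁻ t in Set.Ioc (0 : ℝ) T, ∫⁻ ω, (∑' k : Fin d → ℤ,
        ENNReal.ofReal (znorm k ^ 2) * (‖a ω t k‖₊ : ℝ≥0∞) ^ 2) ∂ℙ =
      (∫⁻ t in Set.Ioc (0 : ℝ) T, ∫⁻ ω, (∑' k : Fin d → ℤ, if r ≤ znorm k then
        ENNReal.ofReal (znorm k ^ 2) * (‖a ω t k‖₊ : ℝ≥0∞) ^ 2 else 0) ∂ℙ) +
      ∫⁻ t in Set.Ioc (0 : ℝ) T, ∫⁻ ω, (∑' k : Fin d → ℤ, if r ≤ znorm k then 0 else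
        ENNReal.ofReal (znorm k ^ 2) * (‖a ω t k‖₊ : ℝ≥0∞) ^ 2) ∂ℙ := by
    rw [← lintegral_add_left hhigh.lintegral_prod_left']
    refine lintegral_congr fun t => ?_
    have hhigh_t := hhigh.comp (measurable_prodMk_right (y := t))
    simp only [Function.comp_def] at hhigh_t
    rw [← lintegral_add_left hhigh_t]
    exact lintegral_congr fun ω => tsum_split_ite (fun k => r ≤ znorm k) _
  rw [← hE, hsplitT, hsplit]
  ring

/-- below the Batchelor scale, after time `C log r`, at least half of the
energy has either reached frequencies of modulus `≥ r` or been dissipated there. -/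
theorem half_energy_past_r (K γ : ℝ) (hK : 1 ≤ K) (hγ : 0 < γ) :
    ∃ C : ℝ, 2 ≤ C ∧
      ∀ (d : ℕ), 1 ≤ d →
      ∀ (ν : ℝ), 0 < ν → ν ≤ Real.exp (-1) →
      ∀ (Ω : Type) [MeasurableSpace Ω] (ℙ : Measure Ω) [IsProbabilityMeasure ℙ]
        (a : Ω → ℝ → (Fin d → ℤ) → ℂ),
      ProbSetup ℙ ν K γ a →
      ∀ r T : ℝ, 2 ≤ r → r ≤ ν ^ (-(1 / 2) : ℝ) / (C * Real.sqrt (Real.log ν⁻¹)) →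
        C * Real.log r ≤ T →
        (2 : ℝ≥0∞)⁻¹ ≤
          (∫⁻ ω, massOn (a ω T) (Set.Ici r) ∂ℙ)
            + ENNReal.ofReal (8 * π ^ 2 * ν) *
              ∫⁻ t in Set.Ioc (0 : ℝ) T, ∫⁻ ω, (∑' k : Fin d → ℤ, if r ≤ znorm k then
                ENNReal.ofReal (znorm k ^ 2) * (‖a ω t k‖₊ : ℝ≥0∞) ^ 2 else 0) ∂ℙ := by
  have hD : 0 ≤ 32 * π ^ 2 * ((1 + 4 * π ^ 2 * K) / γ) := by positivity
  have hM : 0 ≤ (2 + 32 * π ^ 2 * K) / γ := by positivity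
  refine ⟨2 + (2 + 32 * π ^ 2 * K) / γ + 32 * π ^ 2 * ((1 + 4 * π ^ 2 * K) / γ),
    by linarith, ?_⟩
  set C := 2 + (2 + 32 * π ^ 2 * K) / γ + 32 * π ^ 2 * ((1 + 4 * π ^ 2 * K) / γ) with hCdef
  intro d _ ν hν hν1 Ω _ ℙ _ a h r T hr hrν hT
  have hC₁ : 2 + 32 * π ^ 2 * K ≤ γ * C := by
    rw [← div_le_iff₀' hγ]
    linarith
  have hlog : 0 < Real.log r := Real.log_pos (by linarith)
  have hT0 : 0 < T := lt_of_lt_of_le (mul_pos (by linarith) hlog) hT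
  have hlowT := (expected_low_mass_le h r hT0).2.trans
    (ENNReal.ofReal_le_ofReal (mixing_remainder_le hK hγ hC₁ hr hT))
  have hstep : ∀ t, (∫⁻ ω, (∑' k : Fin d → ℤ, if r ≤ znorm k then 0 else
      ENNReal.ofReal (znorm k ^ 2) * (‖a ω t k‖₊ : ℝ≥0∞) ^ 2) ∂ℙ) ≤ ENNReal.ofReal (r ^ 2) *
        ∫⁻ ω, (∑' k : Fin d → ℤ, if r ≤ znorm k then 0 else (‖a ω t k‖₊ : ℝ≥0∞) ^ 2) ∂ℙ := by
    intro t
    rw [← lintegral_const_mul' _ _ ENNReal.ofReal_ne_top]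
    exact lintegral_mono fun ω => low_dissipation_le_mass (a ω t) r
  have hdiss := lintegral_le_of_le_const_of_le_exp (T := T) (A := r ^ 2)
    (B := r ^ 2 * ((2 * π * r) ^ 2 * K)) (γ := γ) (s := 2 / γ * Real.log r)
    (f := fun t => ∫⁻ ω, (∑' k : Fin d → ℤ, if r ≤ znorm k then 0 else
      ENNReal.ofReal (znorm k ^ 2) * (‖a ω t k‖₊ : ℝ≥0∞) ^ 2) ∂ℙ)
    (by positivity) (by positivity) hγ (by positivity)
    (fun t ht => (hstep t).trans (mul_le_of_le_one_right' (expected_low_mass_le h r ht).1))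
    (fun t ht => (hstep t).trans (by
      rw [mul_assoc, mul_assoc, ENNReal.ofReal_mul (sq_nonneg r)]
      gcongr
      exact (expected_low_mass_le h r ht).2))
  have hlow := add_le_add hlowT ((mul_le_mul_right hdiss (ENNReal.ofReal (8 * π ^ 2 * ν))).trans
    ((ENNReal.ofReal_mul (by positivity)).symm.le.trans (ENNReal.ofReal_le_ofReal
      (low_dissipation_bound hK hγ (by linarith) (by linarith) hν hν1 hr hrν))))
  have hhalf : ENNReal.ofReal (1 / 4) + ENNReal.ofReal (1 / 4) = 2⁻¹ := by
    rw [← ENNReal.ofReal_add (by norm_num) (by norm_num), ← ENNReal.ofReal_ofNat 2,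
      ← ENNReal.ofReal_inv_of_pos (by norm_num)]
    norm_num
  rw [hhalf] at hlow
  have hsum := (expected_energy_split h r hT0).le.trans (add_le_add_right hlow _)
  rw [← ENNReal.inv_two_add_inv_two] at hsum
  exact (ENNReal.add_le_add_iff_right (by simp)).mp hsum
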